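/- Log subdivision for the named-subtree operator: let f ∈ 𝔸, let P be a plain process tree (containing no ▽ and no △ nodes), and let L be a hierarchical event log (a set of hierarchical traces) with L ⊆ L(▽_f(P)). Then the projection L|₁ satisfies L|₁ ⊆ L(P). -/

import Mathlib

/-- Symbols: activities `a ∈ 𝔸` and recursion markers `△_f`. -/
inductive HSym (A : Type*) where
  | act : A → HSym A
  | mark : A → HSym A

/-- An event is a finite sequence of symbols. -/
abbrev Event (A : Type*) := List (HSym A)

/-- A hierarchical trace is a finite sequence of events. -/
abbrev HTrace (A : Type*) := List (Event A)

/-- Hierarchy concatenation `s.t`: prefix the symbol `s` to every event of the trace `t`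
(for the empty trace it yields the single event `⟨s⟩`). -/
def hcat {A : Type*} (s : HSym A) : HTrace A → HTrace A
  | [] => [[s]]
  | t => t.map (s :: ·)

/-- Interleaving (shuffle) of two sequences. -/
inductive Interleaving {α : Type*} : List α → List α → List α → Prop
  | nil : Interleaving [] [] []
  | left {a t₁ t₂ t} : Interleaving t₁ t₂ t → Interleaving (a :: t₁) t₂ (a :: t)
  | right {a t₁ t₂ t} : Interleaving t₁ t₂ t → Interleaving t₁ (a :: t₂) (a :: t)

/-- Sequence join. -/
def seqJoin {α : Type*} : List (Set (List α)) → Set (List α)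
  | [] => {[]}
  | L :: Ls => {t | ∃ t₁ ∈ L, ∃ t₂ ∈ seqJoin Ls, t = t₁ ++ t₂}

/-- Exclusive-choice join. -/
def choiceJoin {α : Type*} (Ls : List (Set (List α))) : Set (List α) :=
  {t | ∃ L ∈ Ls, t ∈ L}

/-- Members of the loop language. -/
inductive LoopMem {α : Type*} (body redo : Set (List α)) : List α → Prop
  | single {t} : t ∈ body → LoopMem body redo t
  | cons {t t' r} : t ∈ body → t' ∈ redo → LoopMem body redo r →
      LoopMem body redo (t ++ t' ++ r)

/-- Structured-loop join. -/
def loopJoin {α : Type*} : List (Set (List α)) → Set (List α)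
  | [] => ∅
  | L :: Ls => {t | LoopMem L (choiceJoin Ls) t}

/-- Parallel join. -/
def parJoin {α : Type*} : List (Set (List α)) → Set (List α)
  | [] => {[]}
  | L :: Ls => {t | ∃ t₁ ∈ L, ∃ t₂ ∈ parJoin Ls, Interleaving t₁ t₂ t}

/-- Hierarchical process trees: process trees extended with the named-subtree
operator `▽_f` and the recursion leaf `△_f`. -/
inductive HTree (A : Type*) where
  | act : A → HTree A
  | tau : HTree A
  | seq : List (HTree A) → HTree A
  | choice : List (HTree A) → HTree A
  | loop : List (HTree A) → HTree A
  | par : List (HTree A) → HTree A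
  | named : A → HTree A → HTree A
  | recCall : A → HTree A

universe u

mutual
/-- `▽ˡ_f(M)`: the least hierarchical language satisfying
`▽ˡ_f(M) = { f.(t′₁ ⋯ t′ₙ) | ⟨x₁,…,xₙ⟩ ∈ M, t′ᵢ ∈ ψ_f(xᵢ) }`. -/
inductive NamedLang {A : Type u} (f : A) (M : Set (HTrace A)) : HTrace A → Prop
  | mk (xs : HTrace A) (ts : List (HTrace A)) :
      xs ∈ M → ts.length = xs.length →
      (∀ i, Psi f M (xs.getD i []) (ts.getD i [])) →
      NamedLang f M (hcat (HSym.act f) ts.flatten)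

/-- `ψ_f`: maps an event to the set of traces resolving the recursion markers `△_f`. -/
inductive Psi {A : Type u} (f : A) (M : Set (HTrace A)) : Event A → HTrace A → Prop
  | nil : Psi f M [] []
  | recSame {t : HTrace A} : NamedLang f M t → Psi f M [HSym.mark f] t
  | recOther {g : A} : g ≠ f → Psi f M [HSym.mark g] [[HSym.mark g]]
  | act {a : A} {x : Event A} {t : HTrace A} :
      Psi f M x t → Psi f M (HSym.act a :: x) (hcat (HSym.act a) t)
end

/-- The hierarchical language of a hierarchical process tree. -/
def hlang {A : Type*} : HTree A → Set (HTrace A)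
  | .act a => {[[HSym.act a]]}
  | .tau => {[]}
  | .recCall f => {[[HSym.mark f]]}
  | .seq Ps => seqJoin (Ps.attach.map fun p => hlang p.1)
  | .choice Ps => choiceJoin (Ps.attach.map fun p => hlang p.1)
  | .loop Ps => loopJoin (Ps.attach.map fun p => hlang p.1)
  | .par Ps => parJoin (Ps.attach.map fun p => hlang p.1)
  | .named f P => {t | NamedLang f (hlang P) t}
termination_by P => sizeOf P
decreasing_by
  all_goals first
    | (have := List.sizeOf_lt_of_mem p.2; simp; omega)
    | simp

/-- Plain process trees: no named subtrees `▽` and no recursion leaves `△`. -/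
inductive IsPlain {A : Type*} : HTree A → Prop
  | act (a : A) : IsPlain (HTree.act a)
  | tau : IsPlain HTree.tau
  | seq {Ps : List (HTree A)} : (∀ P ∈ Ps, IsPlain P) → IsPlain (HTree.seq Ps)
  | choice {Ps : List (HTree A)} : (∀ P ∈ Ps, IsPlain P) → IsPlain (HTree.choice Ps)
  | loop {Ps : List (HTree A)} : (∀ P ∈ Ps, IsPlain P) → IsPlain (HTree.loop Ps)
  | par {Ps : List (HTree A)} : (∀ P ∈ Ps, IsPlain P) → IsPlain (HTree.par Ps)


/-- Projection of a hierarchical trace: remove the first symbol of every event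
and discard events that thereby become empty. -/
def projTrace {A : Type*} (t : HTrace A) : HTrace A :=
  (t.map List.tail).filter (fun x => !x.isEmpty)

/-- Projection of a hierarchical event log. -/
def projLog {A : Type*} (L : Set (HTrace A)) : Set (HTrace A) :=
  projTrace '' L

theorem Interleaving.mem_or_mem {α : Type*} {t₁ t₂ t : List α} (h : Interleaving t₁ t₂ t)
    {e : α} (he : e ∈ t) : e ∈ t₁ ∨ e ∈ t₂ := by
  induction h with
  | nil => simp at he
  | left _ ih => grind
  | right _ ih => grind

theorem forall_mem_of_mem_seqJoin {α : Type*} {p : α → Prop} {Ls : List (Set (List α))}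
    (h : ∀ L ∈ Ls, ∀ t ∈ L, ∀ e ∈ t, p e) : ∀ t ∈ seqJoin Ls, ∀ e ∈ t, p e := by
  induction Ls with
  | nil => simp [seqJoin]
  | cons L Ls ih =>
    rintro _ ⟨t₁, h₁, t₂, h₂, rfl⟩ e he
    rcases List.mem_append.1 he with he | he
    · exact h L (by simp) t₁ h₁ e he
    · exact ih (fun K hK => h K (by simp [hK])) t₂ h₂ e he

theorem forall_mem_of_mem_choiceJoin {α : Type*} {p : α → Prop} {Ls : List (Set (List α))}
    (h : ∀ L ∈ Ls, ∀ t ∈ L, ∀ e ∈ t, p e) : ∀ t ∈ choiceJoin Ls, ∀ e ∈ t, p e := by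
  rintro t ⟨L, hL, ht⟩
  exact h L hL t ht

theorem forall_mem_of_mem_loopJoin {α : Type*} {p : α → Prop} {Ls : List (Set (List α))}
    (h : ∀ L ∈ Ls, ∀ t ∈ L, ∀ e ∈ t, p e) : ∀ t ∈ loopJoin Ls, ∀ e ∈ t, p e := by
  cases Ls with
  | nil => simp [loopJoin]
  | cons L Ls =>
    intro t (ht : LoopMem L (choiceJoin Ls) t)
    induction ht with
    | single ht => exact h L (by simp) _ ht
    | cons ht ht' _ ih =>
      intro e he
      simp only [List.mem_append] at he
      rcases he with (he | he) | he
      · exact h L (by simp) _ ht e he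
      · exact forall_mem_of_mem_choiceJoin (fun K hK => h K (by simp [hK])) _ ht' e he
      · exact ih e he

theorem forall_mem_of_mem_parJoin {α : Type*} {p : α → Prop} {Ls : List (Set (List α))}
    (h : ∀ L ∈ Ls, ∀ t ∈ L, ∀ e ∈ t, p e) : ∀ t ∈ parJoin Ls, ∀ e ∈ t, p e := by
  induction Ls with
  | nil => simp [parJoin]
  | cons L Ls ih =>
    rintro t ⟨t₁, h₁, t₂, h₂, ht⟩ e he
    rcases ht.mem_or_mem he with he | he
    · exact h L (by simp) t₁ h₁ e he
    · exact ih (fun K hK => h K (by simp [hK])) t₂ h₂ e he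

/-- Every event of a trace of a plain process tree is a single activity. -/
theorem IsPlain.exists_eq_act {A : Type*} {P : HTree A} (hP : IsPlain P) :
    ∀ t ∈ hlang P, ∀ e ∈ t, ∃ a, e = [HSym.act a] := by
  induction hP with
  | act a => simp [hlang]
  | tau => simp [hlang]
  | seq _ ih =>
    rw [hlang]
    exact forall_mem_of_mem_seqJoin (by simpa using ih)
  | choice _ ih =>
    rw [hlang]
    exact forall_mem_of_mem_choiceJoin (by simpa using ih)
  | loop _ ih =>
    rw [hlang]
    exact forall_mem_of_mem_loopJoin (by simpa using ih)
  | par _ ih =>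
    rw [hlang]
    exact forall_mem_of_mem_parJoin (by simpa using ih)

theorem Psi.eq_of_act {A : Type*} {f a : A} {M : Set (HTrace A)} {t : HTrace A}
    (h : Psi f M [HSym.act a] t) : t = [[HSym.act a]] := by
  cases h with
  | act h =>
    cases h
    rfl

theorem Psi.flatten_eq {A : Type*} {f : A} {M : Set (HTrace A)} {xs : HTrace A}
    {ts : List (HTrace A)} (hxs : ∀ e ∈ xs, ∃ a, e = [HSym.act a])
    (hlen : ts.length = xs.length) (h : ∀ i, Psi f M (xs.getD i []) (ts.getD i [])) :
    ts.flatten = xs := by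
  induction xs generalizing ts with
  | nil => simp [List.length_eq_zero_iff.1 hlen]
  | cons x xs ih =>
    cases ts with
    | nil => simp at hlen
    | cons t ts =>
      obtain ⟨a, rfl⟩ := hxs x (by simp)
      obtain rfl := Psi.eq_of_act (by simpa using h 0)
      rw [List.flatten_cons, ih (fun e he => hxs e (by simp [he])) (by simpa using hlen)
        (fun i => by simpa using h (i + 1)), List.singleton_append]

theorem projTrace_hcat {A : Type*} (s : HSym A) {t : HTrace A} (ht : ∀ e ∈ t, e ≠ []) :
    projTrace (hcat s t) = t := by
  cases t with
  | nil => simp [hcat, projTrace]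
  | cons x t => simpa [hcat, projTrace, Function.comp_def] using ht

/-- log subdivision for the named-subtree operator. -/
theorem log_subdivision_named {A : Type*} (f : A) (P : HTree A) (hP : IsPlain P)
    (L : Set (HTrace A)) (hL : L ⊆ hlang (HTree.named f P)) :
    projLog L ⊆ hlang P := by
  rintro _ ⟨t, ht, rfl⟩
  have h := hL ht
  rw [hlang] at h
  obtain ⟨xs, ts, hxs, hlen, hpsi⟩ := h
  have hact := hP.exists_eq_act xs hxs
  rw [Psi.flatten_eq hact hlen hpsi, projTrace_hcat]
  · exact hxs
  · intro e he
    obtain ⟨a, rfl⟩ := hact e he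
    simp
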